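/- Let ν > 1 and r > 0. For 0 < ε < νr set r₀(ε) := ((ν²+1)/2)·r · [ 1 + (1−ν²)·r / √((ν²+1)²r² − 4(νr−ε)²) ] and θ_c(ε) := arccos( 2(νr−ε)/((ν²+1)r) ). Then the apical-singularity contribution of a hyperspindle to the second quermassintegral vanishes: lim_{ε→0⁺} π · ∫₀^{θ_c(ε)} r₀(ε)² sin²θ dθ = 0. -/

import Mathlib

open Real

/-- Radius of the hypersphere continuously completing a hyperspindle near an apex. -/
noncomputable def r₀sph (ν r ε : ℝ) : ℝ :=
  ((ν ^ 2 + 1) / 2) * r *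
    (1 + (1 - ν ^ 2) * r / Real.sqrt ((ν ^ 2 + 1) ^ 2 * r ^ 2 - 4 * (ν * r - ε) ^ 2))

/-- Angular cutoff of the hypersphere completion near the apex. -/
noncomputable def θc (ν r ε : ℝ) : ℝ :=
  Real.arccos (2 * (ν * r - ε) / ((ν ^ 2 + 1) * r))

/-- At the apex the completing hypersphere degenerates to a point. -/
theorem r₀sph_zero {ν r : ℝ} (hν : 1 < ν) (hr : 0 < r) : r₀sph ν r 0 = 0 := by
  have hpos : 0 < (ν ^ 2 - 1) * r := mul_pos (by nlinarith) hr
  have hsq : (ν ^ 2 + 1) ^ 2 * r ^ 2 - 4 * (ν * r - 0) ^ 2 = ((ν ^ 2 - 1) * r) ^ 2 := by ring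
  have hquot : (1 - ν ^ 2) * r / ((ν ^ 2 - 1) * r) = -1 := by
    rw [div_eq_iff hpos.ne']
    ring
  rw [r₀sph, hsq, Real.sqrt_sq hpos.le, hquot]
  ring

theorem continuousAt_r₀sph_zero {ν r : ℝ} (hν : 1 < ν) (hr : 0 < r) :
    ContinuousAt (r₀sph ν r) 0 := by
  have hpos : 0 < (ν ^ 2 - 1) * r := mul_pos (by nlinarith) hr
  have hsqrt : Real.sqrt ((ν ^ 2 + 1) ^ 2 * r ^ 2 - 4 * (ν * r - 0) ^ 2) ≠ 0 := by
    refine (Real.sqrt_pos.2 ?_).ne'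
    nlinarith [pow_pos hpos 2]
  unfold r₀sph
  exact continuousAt_const.mul (continuousAt_const.add
    (continuousAt_const.div (by fun_prop) hsqrt))

theorem continuous_θc (ν r : ℝ) : Continuous (θc ν r) := by
  unfold θc
  exact Real.continuous_arccos.comp (by fun_prop)

/-- The apical-singularity contribution of a four-dimensional hyperspindle to its
second quermassintegral vanishes. -/
theorem hyperspindle_apex_W2_vanishes (ν r : ℝ) (hν : 1 < ν) (hr : 0 < r) :
    Filter.Tendsto
      (fun ε : ℝ => π * ∫ θ in (0 : ℝ)..(θc ν r ε), r₀sph ν r ε ^ 2 * Real.sin θ ^ 2)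
      (nhdsWithin 0 (Set.Ioi 0))
      (nhds 0) := by
  have hθ := (continuous_θc ν r).continuousAt (x := 0)
  have hcont : ContinuousAt (fun ε : ℝ => π * (r₀sph ν r ε ^ 2 *
      ((Real.sin 0 * Real.cos 0 - Real.sin (θc ν r ε) * Real.cos (θc ν r ε)
        + θc ν r ε - 0) / 2))) 0 := by
    have hr₀ := continuousAt_r₀sph_zero hν hr
    fun_prop
  simp only [intervalIntegral.integral_const_mul, integral_sin_sq]
  simpa [ContinuousAt, r₀sph_zero hν hr] using hcont.tendsto.mono_left nhdsWithin_le_nhds
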